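/- arXiv:2410.09435 — 2 statements merged into one kernel-verified Lean document; each statement's English description precedes it below -/
import Mathlib

section
/- Let n = 4 with costs c_1 ≤ c_2 ≤ c_3 ≤ c_4, and let (q, q') be a two-period orbit in which q_i > 0 and q'_i > 0 for i ∈ {1,2,3}, q_4 = q'_4 = 0, and Δ := q'_1 − q_1 > 0. Then Δ < (A + c_1 + c_2 − 3c_3)/2 and Δ ≤ (2/3)c_4 − (A + c_1 + c_2 + c_3)/6. -/
/-- Cournot best-response map. -/
noncomputable def BR (n : ℕ) (A : ℝ) (c : Fin n → ℝ) (q : Fin n → ℝ) : Fin n → ℝ :=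
  fun i => max 0 ((A - ∑ j ∈ Finset.univ.erase i, q j - c i) / 2)

theorem two_mul_eq_of_BR_pos {n : ℕ} {A : ℝ} {c q : Fin n → ℝ} {i : Fin n}
    (h : 0 < BR n A c q i) :
    2 * BR n A c q i = A - (∑ j, q j - q i) - c i := by
  have hs := Finset.sum_erase_eq_sub (f := q) (Finset.mem_univ i)
  unfold BR at h ⊢
  rw [hs] at h ⊢
  rcases max_cases 0 ((A - (∑ j, q j - q i) - c i) / 2) with h' | h' <;> linarith

theorem le_of_BR_eq_zero {n : ℕ} {A : ℝ} {c q : Fin n → ℝ} {i : Fin n}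
    (h : BR n A c q i = 0) : A - (∑ j, q j - q i) - c i ≤ 0 := by
  have hs := Finset.sum_erase_eq_sub (f := q) (Finset.mem_univ i)
  unfold BR at h
  rw [hs] at h
  have := max_eq_left_iff.mp h
  linarith

/-- bounds on the oscillation amplitude for a 4-firm two-period orbit
with the three cheapest firms always active and the fourth firm silent. -/
theorem stmt_12 (A : ℝ) (hA : 0 < A) (c : Fin 4 → ℝ) (hc : ∀ i, 0 ≤ c i)
    (hsort : c 0 ≤ c 1 ∧ c 1 ≤ c 2 ∧ c 2 ≤ c 3)
    (q q' : Fin 4 → ℝ) (hqnn : ∀ i, 0 ≤ q i) (hq'nn : ∀ i, 0 ≤ q' i)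
    (h1 : q' = BR 4 A c q) (h2 : q = BR 4 A c q')
    (hpos : ∀ i : Fin 4, i.val < 3 → 0 < q i ∧ 0 < q' i)
    (h4 : q 3 = 0 ∧ q' 3 = 0)
    (Δ : ℝ) (hΔ : Δ = q' 0 - q 0) (hΔpos : 0 < Δ) :
    Δ < (A + c 0 + c 1 - 3 * c 2) / 2 ∧
    Δ ≤ (2 / 3) * c 3 - (A + c 0 + c 1 + c 2) / 6 := by
  have active (i : Fin 4) (hi : i.val < 3) :
      2 * q' i = A - (∑ j, q j - q i) - c i ∧ 2 * q i = A - (∑ j, q' j - q' i) - c i := by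
    obtain ⟨hq, hq'⟩ := hpos i hi
    constructor
    · rw [h1] at hq' ⊢
      exact two_mul_eq_of_BR_pos hq'
    · have e := congrFun h2 i
      rw [e] at hq
      have := two_mul_eq_of_BR_pos hq
      rwa [← e] at this
  have silent := le_of_BR_eq_zero ((congrFun h1 3).symm.trans h4.2)
  obtain ⟨a0, b0⟩ := active 0 (by decide)
  obtain ⟨a1, b1⟩ := active 1 (by decide)
  obtain ⟨a2, b2⟩ := active 2 (by decide)
  have p2 := (hpos 2 (by decide)).1
  obtain ⟨z, z'⟩ := h4
  simp only [Fin.sum_univ_four] at a0 b0 a1 b1 a2 b2 silent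
  constructor <;> linarith
end

section
/- Let n = k_1 + k_2 with k_1, k_2 ≥ 1, and let (q, q') be a two-period orbit in which q_i > 0 and q'_i > 0 for every i ≤ k_1, while q_i = 0 and q'_i > 0 for every i with k_1 < i ≤ k_1 + k_2. Then for every l ≤ k_1: 3q_l = (3 − k_1 − k_2)A + (k_1 + k_2 − 2)·Σ_{i≤k_1} q_i + Σ_{i=1}^{n} c_i − 3c_l. -/
/-- An active firm's best response satisfies the first-order condition. -/
theorem two_mul_BR_of_pos {n : ℕ} {A : ℝ} {c q : Fin n → ℝ} {i : Fin n}
    (h : 0 < BR n A c q i) : 2 * BR n A c q i = A - ∑ j, q j + q i - c i := by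
  have hsum := Finset.add_sum_erase Finset.univ q (Finset.mem_univ i)
  unfold BR at h ⊢
  rw [max_eq_right ((lt_max_iff.1 h).resolve_left (lt_irrefl 0)).le]
  linarith

/-- structural identity for the always-active firms of a two-period orbit
with k₁ always-active firms and k₂ firms active only in the second period. -/
theorem stmt_16 (k₁ k₂ : ℕ) (hk₁ : 1 ≤ k₁) (hk₂ : 1 ≤ k₂) (A : ℝ) (hA : 0 < A)
    (c : Fin (k₁ + k₂) → ℝ) (hc : ∀ i, 0 ≤ c i)
    (q q' : Fin (k₁ + k₂) → ℝ) (hqnn : ∀ i, 0 ≤ q i) (hq'nn : ∀ i, 0 ≤ q' i)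
    (h1 : q' = BR (k₁ + k₂) A c q) (h2 : q = BR (k₁ + k₂) A c q')
    (hpos : ∀ i : Fin (k₁ + k₂), i.val < k₁ → 0 < q i ∧ 0 < q' i)
    (hzero : ∀ i : Fin (k₁ + k₂), k₁ ≤ i.val → q i = 0 ∧ 0 < q' i) :
    ∀ l : Fin (k₁ + k₂), l.val < k₁ →
      3 * q l = (3 - (k₁ : ℝ) - (k₂ : ℝ)) * A
        + ((k₁ : ℝ) + (k₂ : ℝ) - 2)
          * (∑ i ∈ Finset.univ.filter (fun i : Fin (k₁ + k₂) => i.val < k₁), q i)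
        + (∑ i, c i) - 3 * c l := by
  intro l hl
  have hq' : ∀ i, 2 * q' i = A - ∑ j, q j + q i - c i := fun i => by
    have hi : 0 < q' i := (lt_or_ge i.val k₁).elim (fun h => (hpos i h).2) (fun h => (hzero i h).2)
    rw [h1] at hi ⊢
    exact two_mul_BR_of_pos hi
  have hql : 2 * q l = A - ∑ j, q' j + q' l - c l := by
    have hl' := (hpos l hl).1
    rw [congrFun h2 l] at hl' ⊢
    exact two_mul_BR_of_pos hl'
  have hactive : ∑ i ∈ Finset.univ.filter (fun i : Fin (k₁ + k₂) => i.val < k₁), q i = ∑ i, q i :=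
    Finset.sum_filter_of_ne fun i _ hi => lt_of_not_ge fun h => hi (hzero i h).1
  have htotal : 2 * ∑ i, q' i
      = ((k₁ : ℝ) + k₂) * (A - ∑ j, q j) + ∑ i, q i - ∑ i, c i := by
    rw [Finset.mul_sum, Finset.sum_congr rfl fun i _ => hq' i, Finset.sum_sub_distrib,
      Finset.sum_add_distrib]
    simp [mul_sub]
  rw [hactive]
  linarith [hq' l]
end
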